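/- Let Ψ : [1,∞) → ℝ₊ be non-decreasing, s ∈ (0,1), and suppose ∑_{t≥1} t·(1/(t²Ψ(t)))^s = ∞. Then the s-dimensional Hausdorff measure of K(Ψ) = {x ∈ [0,1) : |x − p/q| < 1/(q²Ψ(q)) for infinitely many (p,q) ∈ ℤ×ℕ} is infinite. -/

import Mathlib

open Set MeasureTheory

/-- A bounded nonnegative measurable function on `ℝ` such that multiplying by it preserves, up to a
constant factor, uniform bounds on the integrals over subintervals of `[0, 1]`. -/
structure IsTame (f : ℝ → ℝ) : Prop where
  measurable : Measurable f
  nonneg : ∀ x, 0 ≤ f x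
  bdd : ∃ M, ∀ x, f x ≤ M
  disc : ∃ K, 0 ≤ K ∧ ∀ (g : ℝ → ℝ) (h : ℝ), Measurable g → (∃ B, ∀ x, |g x| ≤ B) →
    (∀ a b, a ∈ Icc (0 : ℝ) 1 → b ∈ Icc (0 : ℝ) 1 → |∫ x in Icc a b, g x| ≤ h) →
    ∀ a b, a ∈ Icc (0 : ℝ) 1 → b ∈ Icc (0 : ℝ) 1 → |∫ x in Icc a b, f x * g x| ≤ K * h

theorem integrableOn_Icc_of_bounded {f : ℝ → ℝ} (hf : Measurable f) (hb : ∃ B, ∀ x, |f x| ≤ B)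
    (a b : ℝ) : IntegrableOn f (Icc a b) := by
  obtain ⟨B, hB⟩ := hb
  exact Measure.integrableOn_of_bounded (M := B) (by simp) hf.aestronglyMeasurable
    (Filter.Eventually.of_forall hB)

namespace IsTame

variable {f g : ℝ → ℝ}

theorem abs_bdd (hf : IsTame f) : ∃ B, ∀ x, |f x| ≤ B := by
  obtain ⟨M, hM⟩ := hf.bdd
  exact ⟨M, fun x => by rw [abs_of_nonneg (hf.nonneg x)]; exact hM x⟩

theorem integrableOn (hf : IsTame f) (a b : ℝ) : IntegrableOn f (Icc a b) :=
  integrableOn_Icc_of_bounded hf.measurable hf.abs_bdd a b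

theorem integrableOn_mul (hf : IsTame f) (hg : Measurable g) (hb : ∃ B, ∀ x, |g x| ≤ B)
    (a b : ℝ) : IntegrableOn (fun x => f x * g x) (Icc a b) := by
  obtain ⟨M, hM⟩ := hf.abs_bdd
  obtain ⟨B, hB⟩ := hb
  refine integrableOn_Icc_of_bounded (hf.measurable.mul hg) ⟨M * B, fun x => ?_⟩ a b
  rw [Pi.mul_apply, abs_mul]
  exact mul_le_mul (hM x) (hB x) (abs_nonneg _) ((abs_nonneg _).trans (hM x))

theorem one : IsTame (fun _ => 1) where
  measurable := measurable_const
  nonneg _ := zero_le_one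
  bdd := ⟨1, fun _ => le_rfl⟩
  disc := ⟨1, zero_le_one, fun g h _ _ H a b ha hb => by simpa using H a b ha hb⟩

theorem zero : IsTame (fun _ => 0) where
  measurable := measurable_const
  nonneg _ := le_rfl
  bdd := ⟨0, fun _ => le_rfl⟩
  disc := ⟨0, le_rfl, fun g h _ _ H a b ha hb => by simp⟩

theorem add (hf : IsTame f) (hg : IsTame g) : IsTame (fun x => f x + g x) where
  measurable := hf.measurable.add hg.measurable
  nonneg x := add_nonneg (hf.nonneg x) (hg.nonneg x)
  bdd := by
    obtain ⟨M, hM⟩ := hf.bdd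
    obtain ⟨N, hN⟩ := hg.bdd
    exact ⟨M + N, fun x => add_le_add (hM x) (hN x)⟩
  disc := by
    obtain ⟨K, hK, H⟩ := hf.disc
    obtain ⟨L, hL, H'⟩ := hg.disc
    refine ⟨K + L, add_nonneg hK hL, fun u h hu hub huh a b ha hb => ?_⟩
    simp only [add_mul]
    rw [integral_add (hf.integrableOn_mul hu hub a b) (hg.integrableOn_mul hu hub a b)]
    exact (abs_add_le _ _).trans (add_le_add (H u h hu hub huh a b ha hb)
      (H' u h hu hub huh a b ha hb))

theorem const_mul (hf : IsTame f) {c : ℝ} (hc : 0 ≤ c) : IsTame (fun x => c * f x) where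
  measurable := hf.measurable.const_mul c
  nonneg x := mul_nonneg hc (hf.nonneg x)
  bdd := by
    obtain ⟨M, hM⟩ := hf.bdd
    exact ⟨c * M, fun x => mul_le_mul_of_nonneg_left (hM x) hc⟩
  disc := by
    obtain ⟨K, hK, H⟩ := hf.disc
    refine ⟨c * K, mul_nonneg hc hK, fun u h hu hub huh a b ha hb => ?_⟩
    simp only [mul_assoc]
    rw [integral_const_mul, abs_mul, abs_of_nonneg hc]
    exact mul_le_mul_of_nonneg_left (H u h hu hub huh a b ha hb) hc

theorem indicator (hf : IsTame f) {c d : ℝ} (hc : c ∈ Icc (0 : ℝ) 1) (hd : d ∈ Icc (0 : ℝ) 1) :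
    IsTame ((Icc c d).indicator f) where
  measurable := hf.measurable.indicator measurableSet_Icc
  nonneg x := indicator_nonneg (fun x _ => hf.nonneg x) x
  bdd := by
    obtain ⟨M, hM⟩ := hf.bdd
    exact ⟨M, fun x => (indicator_le_self' (fun x _ => hf.nonneg x) x).trans (hM x)⟩
  disc := by
    obtain ⟨K, hK, H⟩ := hf.disc
    refine ⟨K, hK, fun u h hu hub huh a b ha hb => ?_⟩
    simp only [← indicator_mul_left]
    rw [setIntegral_indicator measurableSet_Icc, Icc_inter_Icc]
    exact H u h hu hub huh _ _ ⟨le_sup_of_le_left ha.1, sup_le ha.2 hc.2⟩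
      ⟨le_inf hb.1 hd.1, inf_le_of_left_le hb.2⟩

theorem sum {ι : Type*} (t : Finset ι) {F : ι → ℝ → ℝ} (h : ∀ i ∈ t, IsTame (F i)) :
    IsTame (fun x => ∑ i ∈ t, F i x) := by
  classical
  induction t using Finset.induction_on with
  | empty => simpa using zero
  | insert i t hi ih =>
    simp only [Finset.sum_insert hi]
    exact (h i (by simp)).add (ih fun j hj => h j (by simp [hj]))

end IsTame

/-- The number of elements of `t` (counted as fractions `p / q`) whose right neighbourhood
of length `r` contains a given point. -/
noncomputable def overlap (t : Finset (Σ _ : ℕ, ℕ)) (r x : ℝ) : ℝ :=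
  ∑ i ∈ t, (Icc ((i.2 : ℝ) / i.1) (i.2 / i.1 + r)).indicator 1 x

theorem overlap_measurable (t : Finset (Σ _ : ℕ, ℕ)) (r : ℝ) : Measurable (overlap t r) :=
  Finset.measurable_fun_sum _ fun _ _ => measurable_one.indicator measurableSet_Icc

theorem overlap_nonneg (t : Finset (Σ _ : ℕ, ℕ)) (r x : ℝ) : 0 ≤ overlap t r x :=
  Finset.sum_nonneg fun _ _ => indicator_nonneg (fun _ _ => zero_le_one) x

theorem overlap_bdd (t : Finset (Σ _ : ℕ, ℕ)) (r : ℝ) : ∃ B, ∀ x, |overlap t r x| ≤ B := by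
  refine ⟨∑ i ∈ t, 1, fun x => ?_⟩
  rw [abs_of_nonneg (overlap_nonneg t r x)]
  exact Finset.sum_le_sum fun i _ => indicator_le_self' (fun _ _ => zero_le_one) x

theorem overlap_mono {t u : Finset (Σ _ : ℕ, ℕ)} (h : t ⊆ u) (r x : ℝ) :
    overlap t r x ≤ overlap u r x :=
  Finset.sum_le_sum_of_subset_of_nonneg h fun _ _ _ => indicator_nonneg (fun _ _ => zero_le_one) x

theorem integral_indicator_Icc (a b c d : ℝ) :
    ∫ x in Icc a b, (Icc c d).indicator (1 : ℝ → ℝ) x = max (min b d - max a c) 0 := by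
  rw [integral_indicator_one measurableSet_Icc, measureReal_restrict_apply measurableSet_Icc,
    inter_comm, Icc_inter_Icc, Real.volume_real_Icc]

theorem integral_overlap (t : Finset (Σ _ : ℕ, ℕ)) (r a b : ℝ) :
    ∫ x in Icc a b, overlap t r x
      = ∑ i ∈ t, max (min b ((i.2 : ℝ) / i.1 + r) - max a ((i.2 : ℝ) / i.1)) 0 := by
  unfold overlap
  rw [integral_finsetSum]
  · simp only [integral_indicator_Icc]
  · intro i _
    exact integrableOn_Icc_of_bounded (measurable_one.indicator measurableSet_Icc)
      ⟨1, fun x => by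
        by_cases h : x ∈ Icc ((i.2 : ℝ) / i.1) (i.2 / i.1 + r) <;> simp [h]⟩ a b

theorem abs_sum_range_sub_le {q : ℕ} (hq : 0 < q) {r : ℝ} (hr : 0 ≤ r) (hrq : r * q ≤ 1) {x : ℝ}
    (hx : x ∈ Icc (0 : ℝ) 1) :
    |∑ p ∈ Finset.range q, max (min x ((p : ℝ) / q + r) - max 0 ((p : ℝ) / q)) 0 - q * r * x|
      ≤ r := by
  have hq' : (0 : ℝ) < q := by exact_mod_cast hq
  set m := ⌊(q : ℝ) * x⌋₊ with hm
  have hqx : 0 ≤ (q : ℝ) * x := mul_nonneg hq'.le hx.1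
  have hm1 : (m : ℝ) ≤ q * x := Nat.floor_le hqx
  have hm2 : (q : ℝ) * x < m + 1 := Nat.lt_floor_add_one _
  have hmq : m ≤ q := by
    have : (m : ℝ) ≤ q := hm1.trans (by nlinarith [hx.2])
    exact_mod_cast this
  have hr' : r ≤ 1 / q := by rwa [le_div_iff₀ hq']
  have hle : ∀ p : ℕ, max (min x ((p : ℝ) / q + r) - max 0 ((p : ℝ) / q)) 0 ≤ r := by
    intro p
    refine max_le ?_ hr
    have := min_le_right x ((p : ℝ) / q + r)
    have := le_max_right 0 ((p : ℝ) / q)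
    linarith
  have up : ∑ p ∈ Finset.range q, max (min x ((p : ℝ) / q + r) - max 0 ((p : ℝ) / q)) 0
      ≤ (m + 1) * r := by
    calc _ ≤ ∑ p ∈ Finset.range q, if p ∈ Finset.range (m + 1) then r else 0 := by
          refine Finset.sum_le_sum fun p _ => ?_
          split_ifs with h
          · exact hle p
          · refine max_le ?_ le_rfl
            have hp : (m : ℝ) + 1 ≤ p := by
              simp only [Finset.mem_range, not_lt] at h
              exact_mod_cast h
            have : x ≤ p / q := by
              rw [le_div_iff₀ hq']; linarith
            have := min_le_left x ((p : ℝ) / q + r)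
            have := le_max_right 0 ((p : ℝ) / q)
            linarith
      _ = (Finset.range q ∩ Finset.range (m + 1)).card * r := by
          rw [Finset.sum_ite_mem, Finset.sum_const, nsmul_eq_mul]
      _ ≤ _ := by
          refine mul_le_mul_of_nonneg_right ?_ hr
          have := Finset.card_le_card (Finset.inter_subset_right (s₁ := Finset.range q)
            (s₂ := Finset.range (m + 1)))
          rw [Finset.card_range] at this
          exact_mod_cast this
  have low : (m : ℝ) * r
      ≤ ∑ p ∈ Finset.range q, max (min x ((p : ℝ) / q + r) - max 0 ((p : ℝ) / q)) 0 := by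
    calc (m : ℝ) * r = ∑ p ∈ Finset.range m, r := by simp
      _ ≤ ∑ p ∈ Finset.range m, max (min x ((p : ℝ) / q + r) - max 0 ((p : ℝ) / q)) 0 := by
          refine Finset.sum_le_sum fun p hp => ?_
          have hp : (p : ℝ) + 1 ≤ m := by
            simp only [Finset.mem_range] at hp
            exact_mod_cast hp
          refine le_max_of_le_left ?_
          rw [max_eq_right (by positivity), min_eq_right]
          · linarith
          · have : (p : ℝ) / q + 1 / q ≤ x := by
              rw [← add_div, div_le_iff₀ hq']; linarith
            linarith
      _ ≤ _ := Finset.sum_le_sum_of_subset_of_nonneg (Finset.range_mono hmq)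
          fun _ _ _ => le_max_right _ _
  rw [abs_le]
  constructor <;> nlinarith

theorem integral_Icc_eq_sub {g : ℝ → ℝ} (hg : ∀ a b, IntegrableOn g (Icc a b)) {a b : ℝ}
    (ha : 0 ≤ a) (hab : a ≤ b) :
    ∫ x in Icc a b, g x = (∫ x in Icc 0 b, g x) - ∫ x in Icc 0 a, g x := by
  have hI : ∀ c d : ℝ, IntervalIntegrable g volume c d := fun c d =>
    ⟨(hg c d).mono_set Ioc_subset_Icc_self, (hg d c).mono_set Ioc_subset_Icc_self⟩
  simp only [integral_Icc_eq_integral_Ioc]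
  rw [← intervalIntegral.integral_of_le hab, ← intervalIntegral.integral_of_le ha,
    ← intervalIntegral.integral_of_le (ha.trans hab),
    intervalIntegral.integral_interval_sub_left (hI _ _) (hI _ _)]

/-- The fractions `p / q ∈ [0, 1)`, not necessarily reduced, with `2 ^ k ≤ q < 2 ^ (k + 1)`. -/
def dyadicFractions (k : ℕ) : Finset (Σ _ : ℕ, ℕ) :=
  (Finset.Ico (2 ^ k) (2 ^ (k + 1))).sigma fun q => Finset.range q

theorem mem_dyadicFractions {k : ℕ} {i : Σ _ : ℕ, ℕ} :
    i ∈ dyadicFractions k ↔ (2 ^ k ≤ i.1 ∧ i.1 < 2 ^ (k + 1)) ∧ i.2 < i.1 := by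
  simp [dyadicFractions]

theorem card_dyadicFractions (k : ℕ) :
    (dyadicFractions k).card = ∑ q ∈ Finset.Ico (2 ^ k) (2 ^ (k + 1)), q := by
  simp [dyadicFractions]

theorem card_Ico_two_pow (k : ℕ) : (Finset.Ico (2 ^ k) (2 ^ (k + 1))).card = 2 ^ k := by
  rw [Nat.card_Ico, pow_succ]; lia

theorem four_pow_le_card_dyadicFractions (k : ℕ) : 4 ^ k ≤ (dyadicFractions k).card := by
  rw [card_dyadicFractions]
  calc 4 ^ k = (Finset.Ico (2 ^ k) (2 ^ (k + 1))).card • 2 ^ k := by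
        rw [card_Ico_two_pow, smul_eq_mul, ← mul_pow]; norm_num
    _ ≤ _ := Finset.card_nsmul_le_sum _ _ _ fun q hq => (Finset.mem_Ico.1 hq).1

theorem abs_integral_overlap_sub_le {k : ℕ} {r : ℝ} (hr : 0 ≤ r) (hrk : r * 2 ^ (k + 1) ≤ 1)
    {a b : ℝ} (ha : a ∈ Icc (0 : ℝ) 1) (hb : b ∈ Icc (0 : ℝ) 1) :
    |∫ x in Icc a b, (overlap (dyadicFractions k) r x - (dyadicFractions k).card * r)|
      ≤ 2 * 2 ^ k * r := by
  have hint : ∀ a b, IntegrableOn (fun x => overlap (dyadicFractions k) r x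
      - (dyadicFractions k).card * r) (Icc a b) := fun a b =>
    (integrableOn_Icc_of_bounded (overlap_measurable _ r) (overlap_bdd _ r) a b).sub
      (integrableOn_const (by simp))
  have key : ∀ x ∈ Icc (0 : ℝ) 1,
      |∫ y in Icc 0 x, (overlap (dyadicFractions k) r y - (dyadicFractions k).card * r)|
        ≤ 2 ^ k * r := by
    intro x hx
    rw [integral_sub (integrableOn_Icc_of_bounded (overlap_measurable _ r) (overlap_bdd _ r) _ _)
      (integrableOn_const (by simp)), integral_overlap, setIntegral_const, smul_eq_mul,
      Real.volume_real_Icc_of_le hx.1, card_dyadicFractions, dyadicFractions, Finset.sum_sigma,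
      Nat.cast_sum, sub_zero, ← mul_assoc, mul_comm x, mul_right_comm, mul_assoc, Finset.sum_mul,
      ← Finset.sum_sub_distrib]
    calc _ ≤ ∑ q ∈ Finset.Ico (2 ^ k) (2 ^ (k + 1)), r := by
          refine (Finset.abs_sum_le_sum_abs _ _).trans (Finset.sum_le_sum fun q hq => ?_)
          rw [Finset.mem_Ico] at hq
          rw [← mul_assoc]
          refine abs_sum_range_sub_le (lt_of_lt_of_le (by positivity) hq.1) hr ?_ hx
          refine le_trans (mul_le_mul_of_nonneg_left ?_ hr) hrk
          exact_mod_cast hq.2.le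
      _ = _ := by rw [Finset.sum_const, card_Ico_two_pow, nsmul_eq_mul]; push_cast; rfl
  rcases le_or_gt a b with hab | hab
  · rw [integral_Icc_eq_sub hint ha.1 hab]
    refine (abs_sub _ _).trans ?_
    linarith [key a ha, key b hb]
  · rw [Icc_eq_empty (not_le.2 hab)]
    simp only [Measure.restrict_empty, integral_zero_measure, abs_zero]
    positivity

/-- The members of `dyadicFractions k` for which numerator and denominator have greatest common
divisor at most `D`. -/
def almostReduced (k D : ℕ) : Finset (Σ _ : ℕ, ℕ) :=
  (dyadicFractions k).filter fun i => Nat.gcd i.1 i.2 ≤ D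

theorem almostReduced_subset (k D : ℕ) : almostReduced k D ⊆ dyadicFractions k :=
  Finset.filter_subset _ _

theorem card_sdiff_almostReduced_le (k D : ℕ) :
    ((dyadicFractions k \ almostReduced k D).card : ℝ) ≤ 8 * 4 ^ k / (D + 1) := by
  classical
  set N := 2 ^ (k + 1) with hN
  have hsub : dyadicFractions k \ almostReduced k D ⊆ (Finset.Ioo D N).biUnion fun d =>
      (Finset.Icc 1 (N / d) ×ˢ Finset.range (N / d)).image
        fun ba => (⟨d * ba.1, d * ba.2⟩ : Σ _ : ℕ, ℕ) := by
    rintro ⟨q, p⟩ hi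
    simp only [almostReduced, Finset.mem_sdiff, Finset.mem_filter, not_and, not_le,
      mem_dyadicFractions] at hi
    obtain ⟨⟨⟨h1, h2⟩, h3⟩, h4⟩ := hi
    have h4 := h4 ⟨⟨h1, h2⟩, h3⟩
    have hq : 0 < q := lt_of_lt_of_le (by positivity) h1
    have hd0 : 0 < q.gcd p := Nat.gcd_pos_of_pos_left _ hq
    obtain ⟨b, hb⟩ := Nat.gcd_dvd_left q p
    obtain ⟨a, ha⟩ := Nat.gcd_dvd_right q p
    set d := q.gcd p with hd
    simp only [Finset.mem_biUnion, Finset.mem_Ioo, Finset.mem_image, Finset.mem_product,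
      Finset.mem_Icc, Finset.mem_range, Prod.exists]
    have hab : a < b := by
      rw [hb, ha] at h3
      exact lt_of_mul_lt_mul_left h3 (Nat.zero_le _)
    have hbN : b ≤ N / d := by
      rw [Nat.le_div_iff_mul_le hd0, mul_comm, ← hb]; exact h2.le
    refine ⟨d, ⟨h4, lt_of_le_of_lt (Nat.gcd_le_left p hq) h2⟩, b, a,
      ⟨⟨by lia, hbN⟩, by lia⟩, ?_⟩
    rw [← hb, ← ha]
  calc ((dyadicFractions k \ almostReduced k D).card : ℝ)
      ≤ ((∑ d ∈ Finset.Ioo D N, (N / d) ^ 2 : ℕ) : ℝ) := by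
        refine Nat.cast_le.2 ((Finset.card_le_card hsub).trans (Finset.card_biUnion_le.trans ?_))
        refine Finset.sum_le_sum fun d _ => Finset.card_image_le.trans ?_
        rw [Finset.card_product, Nat.card_Icc, Finset.card_range, sq]
        simp
    _ ≤ ∑ d ∈ Finset.Ioo D N, (N : ℝ) ^ 2 * ((d : ℝ) ^ 2)⁻¹ := by
        push_cast
        refine Finset.sum_le_sum fun d _ => ?_
        rw [← div_eq_mul_inv, ← div_pow]
        exact pow_le_pow_left₀ (Nat.cast_nonneg _) Nat.cast_div_le 2
    _ ≤ (N : ℝ) ^ 2 * (2 / (D + 1)) := by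
        rw [← Finset.mul_sum]
        exact mul_le_mul_of_nonneg_left (sum_Ioo_inv_sq_le D N) (by positivity)
    _ = _ := by
        rw [hN]
        push_cast
        rw [← pow_mul, mul_comm (k + 1), pow_mul, pow_succ]
        norm_num
        ring

theorem card_almostReduced_filter_le (k D : ℕ) {a b : ℝ} (hab : a ≤ b) :
    (((almostReduced k D).filter fun i => (i.2 : ℝ) / i.1 ∈ Icc a b).card : ℝ)
      ≤ D * (1 + 4 ^ (k + 1) * (b - a)) := by
  classical
  set M : ℝ := 4 ^ (k + 1) with hM
  have hM0 : 0 < M := by positivity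
  let φ : (Σ _ : ℕ, ℕ) → ℕ × ℕ := fun i => (⌊M * ((i.2 : ℝ) / i.1 - a)⌋₊, Nat.gcd i.1 i.2)
  have hmaps : ∀ i ∈ (almostReduced k D).filter fun i => (i.2 : ℝ) / i.1 ∈ Icc a b,
      φ i ∈ Finset.range (⌊M * (b - a)⌋₊ + 1) ×ˢ Finset.Icc 1 D := by
    rintro ⟨q, p⟩ hi
    simp only [almostReduced, Finset.mem_filter, mem_dyadicFractions] at hi
    obtain ⟨⟨⟨⟨h1, h2⟩, h3⟩, h4⟩, h5⟩ := hi
    have hq : 0 < q := lt_of_lt_of_le (by positivity) h1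
    simp only [φ, Finset.mem_product, Finset.mem_range, Finset.mem_Icc]
    refine ⟨Nat.lt_succ_of_le (Nat.floor_le_floor ?_), Nat.gcd_pos_of_pos_left _ hq, h4⟩
    exact mul_le_mul_of_nonneg_left (sub_le_sub_right h5.2 a) hM0.le
  have hinj : Set.InjOn φ ((almostReduced k D).filter fun i => (i.2 : ℝ) / i.1 ∈ Icc a b) := by
    rintro ⟨q, p⟩ hi ⟨q', p'⟩ hi' hφ
    simp only [almostReduced, Finset.coe_filter, Finset.mem_filter, mem_dyadicFractions,
      Set.mem_ofPred_eq] at hi hi'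
    obtain ⟨⟨⟨⟨h1, h2⟩, h3⟩, h4⟩, h5⟩ := hi
    obtain ⟨⟨⟨⟨h1', h2'⟩, h3'⟩, h4'⟩, h5'⟩ := hi'
    have hq : 0 < q := lt_of_lt_of_le (by positivity) h1
    have hq' : 0 < q' := lt_of_lt_of_le (by positivity) h1'
    simp only [φ, Prod.mk.injEq] at hφ
    obtain ⟨hfl, hg⟩ := hφ
    have hqR : (0 : ℝ) < q := by exact_mod_cast hq
    have hqR' : (0 : ℝ) < q' := by exact_mod_cast hq'
    have hclose : |M * ((p : ℝ) / q - a) - M * ((p' : ℝ) / q' - a)| < 1 := by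
      have e1 := Nat.floor_le (mul_nonneg hM0.le (sub_nonneg.2 h5.1))
      have e2 := Nat.lt_floor_add_one (M * ((p : ℝ) / q - a))
      have e3 := Nat.floor_le (mul_nonneg hM0.le (sub_nonneg.2 h5'.1))
      have e4 := Nat.lt_floor_add_one (M * ((p' : ℝ) / q' - a))
      rw [hfl] at e1 e2
      rw [abs_lt]
      constructor <;> linarith
    have hqq : (q : ℝ) * q' ≤ M := by
      have h2R : (q : ℝ) ≤ 2 ^ (k + 1) := by exact_mod_cast h2.le
      have h2R' : (q' : ℝ) ≤ 2 ^ (k + 1) := by exact_mod_cast h2'.le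
      calc (q : ℝ) * q' ≤ 2 ^ (k + 1) * 2 ^ (k + 1) :=
            mul_le_mul h2R h2R' hqR'.le (by positivity)
        _ = M := by rw [hM, ← mul_pow]; norm_num
    have hdet : (p : ℤ) * q' = p' * q := by
      have e : M * ((p : ℝ) / q - a) - M * ((p' : ℝ) / q' - a)
          = M / (q * q') * ((p : ℝ) * q' - p' * q) := by
        field_simp
        ring
      rw [e, abs_mul, abs_of_pos (by positivity)] at hclose
      have h1M : 1 ≤ M / ((q : ℝ) * q') := by rwa [one_le_div (by positivity)]
      have : |(p : ℝ) * q' - p' * q| < 1 := by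
        nlinarith [abs_nonneg ((p : ℝ) * q' - p' * q)]
      have h' : |(p : ℤ) * q' - p' * q| < 1 := by exact_mod_cast this
      rw [Int.abs_lt_one_iff] at h'
      linarith
    have hdet : p * q' = p' * q := by exact_mod_cast hdet
    have hqeq : q = q' := by
      have e : q.gcd p * q' = q'.gcd p' * q := by
        rw [← Nat.gcd_mul_right, ← Nat.gcd_mul_right, hdet, mul_comm q q']
      rw [hg] at e
      exact (Nat.eq_of_mul_eq_mul_left (Nat.gcd_pos_of_pos_left _ hq') e).symm
    subst hqeq
    have hpeq : p = p' := Nat.eq_of_mul_eq_mul_right hq hdet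
    rw [hpeq]
  have hcard := Finset.card_le_card_of_injOn φ hmaps hinj
  rw [Finset.card_product, Finset.card_range, Nat.card_Icc, Nat.add_sub_cancel] at hcard
  calc _ ≤ (((⌊M * (b - a)⌋₊ + 1) * D : ℕ) : ℝ) := Nat.cast_le.2 hcard
    _ ≤ _ := by
      push_cast
      rw [mul_comm]
      refine mul_le_mul_of_nonneg_left ?_ (Nat.cast_nonneg _)
      have := Nat.floor_le (mul_nonneg hM0.le (sub_nonneg.2 hab))
      linarith

theorem integral_overlap_almostReduced_le (k D : ℕ) {r a b : ℝ} (hr : 0 ≤ r) (hab : a ≤ b) :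
    ∫ x in Icc a b, overlap (almostReduced k D) r x
      ≤ D * (1 + 4 ^ (k + 1) * (b - a + r)) * min r (b - a) := by
  have hmin : 0 ≤ min r (b - a) := le_min hr (sub_nonneg.2 hab)
  rw [integral_overlap]
  calc _ ≤ ∑ i ∈ almostReduced k D,
        if (i.2 : ℝ) / i.1 ∈ Icc (a - r) b then min r (b - a) else 0 := by
        refine Finset.sum_le_sum fun i _ => ?_
        set c : ℝ := (i.2 : ℝ) / i.1
        have h1 := min_le_left b (c + r)
        have h2 := min_le_right b (c + r)
        have h3 := le_max_left a c
        have h4 := le_max_right a c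
        split_ifs with h
        · exact max_le (le_min (by linarith) (by linarith)) hmin
        · refine max_le ?_ le_rfl
          rw [mem_Icc, not_and_or, not_le, not_le] at h
          rcases h with h | h <;> linarith
    _ = (((almostReduced k D).filter fun i => (i.2 : ℝ) / i.1 ∈ Icc (a - r) b).card : ℝ)
          * min r (b - a) := by
        rw [← Finset.sum_filter, Finset.sum_const, nsmul_eq_mul]
    _ ≤ _ := by
        refine mul_le_mul_of_nonneg_right ?_ hmin
        refine (card_almostReduced_filter_le k D (by linarith : a - r ≤ b)).trans (le_of_eq ?_)
        ring

theorem integral_overlap_sub_almostReduced_le (k D : ℕ) {r : ℝ} (hr : 0 ≤ r) :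
    ∫ x in Icc 0 1, (overlap (dyadicFractions k) r x - overlap (almostReduced k D) r x)
      ≤ 8 * (dyadicFractions k).card * r / (D + 1) := by
  classical
  have hI := fun t => integrableOn_Icc_of_bounded (overlap_measurable t r) (overlap_bdd t r) 0 1
  rw [integral_sub (hI _) (hI _), integral_overlap, integral_overlap,
    ← Finset.sum_sdiff (almostReduced_subset k D), add_sub_cancel_right]
  calc _ ≤ ∑ i ∈ dyadicFractions k \ almostReduced k D, r := by
        refine Finset.sum_le_sum fun i _ => max_le ?_ hr
        have := min_le_right 1 ((i.2 : ℝ) / i.1 + r)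
        have := le_max_right 0 ((i.2 : ℝ) / i.1)
        linarith
    _ = ((dyadicFractions k \ almostReduced k D).card : ℝ) * r := by
        rw [Finset.sum_const, nsmul_eq_mul]
    _ ≤ 8 * 4 ^ k / (D + 1) * r :=
        mul_le_mul_of_nonneg_right (card_sdiff_almostReduced_le k D) hr
    _ ≤ _ := by
        have : (4 : ℝ) ^ k ≤ (dyadicFractions k).card := by
          exact_mod_cast four_pow_le_card_dyadicFractions k
        rw [div_mul_eq_mul_div]
        gcongr

/-- For a sequence decreasing at least geometrically, the terms below `ρ` and the terms above `ρ`
both contribute at most a constant multiple of `ρ ^ s`. -/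
theorem exists_sum_rpow_mul_min_le {s : ℝ} (hs : s ∈ Ioo (0 : ℝ) 1) {u : ℕ → ℝ}
    (hu0 : ∀ k, 0 < u k) (hu : ∀ k, u (k + 1) ≤ u k / 4) :
    ∃ C, 0 < C ∧ ∀ ρ, 0 ≤ ρ → ∀ n,
      ∑ k ∈ Finset.range n, u k ^ (s - 1) * min (u k) ρ ≤ C * ρ ^ s := by
  obtain ⟨hs0, hs1⟩ := hs
  have h4 : (4 : ℝ) ^ (-s) < 1 := Real.rpow_lt_one_of_one_lt_of_neg (by norm_num) (by linarith)
  have h4' : (4 : ℝ) ^ (s - 1) < 1 :=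
    Real.rpow_lt_one_of_one_lt_of_neg (by norm_num) (by linarith)
  set c := (1 - (4 : ℝ) ^ (-s))⁻¹ with hc
  set d := (1 - (4 : ℝ) ^ (s - 1))⁻¹ with hd
  have hc0 : 0 < c := inv_pos.2 (by linarith)
  have hd0 : 0 < d := inv_pos.2 (by linarith)
  have hc1 : c * (1 - (4 : ℝ) ^ (-s)) = 1 := inv_mul_cancel₀ (by linarith)
  have hd1 : d * (1 - (4 : ℝ) ^ (s - 1)) = 1 := inv_mul_cancel₀ (by linarith)
  refine ⟨c + d, add_pos hc0 hd0, fun ρ hρ n => ?_⟩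
  rcases hρ.eq_or_lt with rfl | hρ
  · rw [Real.zero_rpow hs0.ne']
    simp [min_eq_right (hu0 _).le]
  have small : ∀ n, ∑ k ∈ Finset.range n, (if u k ≤ ρ then u k ^ s else 0)
      + c * min (u n) ρ ^ s ≤ c * ρ ^ s := by
    intro n
    induction n with
    | zero =>
      simp only [Finset.range_zero, Finset.sum_empty, zero_add]
      exact mul_le_mul_of_nonneg_left
        (Real.rpow_le_rpow (le_min (hu0 0).le hρ.le) (min_le_right _ _) hs0.le) hc0.le
    | succ n ih =>
      refine le_trans ?_ ih
      rw [Finset.sum_range_succ, add_assoc]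
      refine add_le_add le_rfl ?_
      have hm0 : 0 ≤ min (u (n + 1)) ρ := le_min (hu0 _).le hρ.le
      split_ifs with h
      · rw [min_eq_left h]
        have : min (u (n + 1)) ρ ^ s ≤ u n ^ s * 4 ^ (-s) := by
          calc min (u (n + 1)) ρ ^ s ≤ (u n / 4) ^ s :=
                Real.rpow_le_rpow hm0 ((min_le_left _ _).trans (hu n)) hs0.le
            _ = _ := by
                rw [Real.div_rpow (hu0 n).le (by norm_num), Real.rpow_neg (by norm_num),
                  div_eq_mul_inv]
        calc u n ^ s + c * min (u (n + 1)) ρ ^ s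
            ≤ (c * (1 - (4 : ℝ) ^ (-s))) * u n ^ s + c * (u n ^ s * 4 ^ (-s)) := by
              rw [hc1, one_mul]
              exact add_le_add le_rfl (mul_le_mul_of_nonneg_left this hc0.le)
          _ = c * u n ^ s := by ring
      · rw [zero_add, min_eq_right (not_le.1 h).le]
        exact mul_le_mul_of_nonneg_left (Real.rpow_le_rpow hm0 (min_le_right _ _) hs0.le) hc0.le
  have large : ∀ n, ∑ k ∈ Finset.range (n + 1), (if u k ≤ ρ then 0 else u k ^ (s - 1))
      ≤ d * max (u n) ρ ^ (s - 1) := by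
    have hd2 : 1 ≤ d := by
      have : 0 < (4 : ℝ) ^ (s - 1) := by positivity
      nlinarith
    intro n
    induction n with
    | zero =>
      simp only [zero_add, Finset.range_one, Finset.sum_singleton]
      split_ifs with h
      · have := hu0 0; positivity
      · rw [max_eq_left (not_le.1 h).le]
        have : 0 < u 0 ^ (s - 1) := Real.rpow_pos_of_pos (hu0 0) _
        nlinarith
    | succ n ih =>
      rw [Finset.sum_range_succ]
      split_ifs with h
      · rw [add_zero, max_eq_right h]
        exact ih.trans (mul_le_mul_of_nonneg_left
          (Real.rpow_le_rpow_of_nonpos hρ (le_max_right _ _) (by linarith)) hd0.le)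
      · rw [max_eq_left (not_le.1 h).le]
        have h1 : max (u n) ρ ^ (s - 1) ≤ 4 ^ (s - 1) * u (n + 1) ^ (s - 1) := by
          rw [← Real.mul_rpow (by norm_num) (hu0 _).le]
          refine Real.rpow_le_rpow_of_nonpos (mul_pos (by norm_num) (hu0 _))
            (le_max_of_le_left ?_) (by linarith)
          linarith [hu n]
        calc _ ≤ d * (4 ^ (s - 1) * u (n + 1) ^ (s - 1))
              + (d * (1 - (4 : ℝ) ^ (s - 1))) * u (n + 1) ^ (s - 1) := by
              rw [hd1, one_mul]
              exact add_le_add (ih.trans (mul_le_mul_of_nonneg_left h1 hd0.le)) le_rfl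
          _ = _ := by ring
  have split : ∀ k, u k ^ (s - 1) * min (u k) ρ
      = (if u k ≤ ρ then u k ^ s else 0) + ρ * if u k ≤ ρ then 0 else u k ^ (s - 1) := by
    intro k
    split_ifs with h
    · rw [min_eq_left h, mul_zero, add_zero, ← Real.rpow_add_one (hu0 k).ne']
      congr 1; ring
    · rw [min_eq_right (not_le.1 h).le, zero_add, mul_comm]
  simp only [split, Finset.sum_add_distrib, ← Finset.mul_sum]
  rw [add_mul]
  refine add_le_add ?_ ?_
  · refine le_trans (le_add_of_nonneg_right ?_) (small n)
    have := le_min (hu0 n).le hρ.le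
    positivity
  · calc _ ≤ ρ * ∑ k ∈ Finset.range (n + 1), (if u k ≤ ρ then 0 else u k ^ (s - 1)) := by
          refine mul_le_mul_of_nonneg_left ?_ hρ.le
          rw [Finset.sum_range_succ]
          refine le_add_of_nonneg_right ?_
          have := hu0 n
          positivity
      _ ≤ ρ * (d * ρ ^ (s - 1)) := by
          refine mul_le_mul_of_nonneg_left ((large n).trans ?_) hρ.le
          exact mul_le_mul_of_nonneg_left
            (Real.rpow_le_rpow_of_nonpos hρ (le_max_right _ _) (by linarith)) hd0.le
      _ = d * (ρ ^ (s - 1) * ρ) := by ring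
      _ = d * ρ ^ s := by
          rw [← Real.rpow_add_one hρ.ne']
          congr 2; ring

/-- The sum of the `s`-th powers of the lengths `u k` over the dyadic fractions of levels
`m ≤ k < n`. -/
noncomputable def totalWeight (s : ℝ) (u : ℕ → ℝ) (m n : ℕ) : ℝ :=
  ∑ k ∈ Finset.Ico m n, (dyadicFractions k).card * u k ^ s

/-- The density putting mass `u k ^ s`, up to normalization, on the interval of length `u k` to
the right of each fraction in `T k`, for `m ≤ k < n`. -/
noncomputable def levelDensity (s : ℝ) (u : ℕ → ℝ) (m n : ℕ) (T : ℕ → Finset (Σ _ : ℕ, ℕ))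
    (x : ℝ) : ℝ :=
  ∑ k ∈ Finset.Ico m n, u k ^ (s - 1) / totalWeight s u m n * overlap (T k) (u k) x

section levelDensity

variable {s : ℝ} {u : ℕ → ℝ} {m n : ℕ}

theorem totalWeight_nonneg (hu0 : ∀ k, 0 < u k) : 0 ≤ totalWeight s u m n :=
  Finset.sum_nonneg fun k _ => mul_nonneg (Nat.cast_nonneg _) (Real.rpow_nonneg (hu0 k).le _)

theorem sum_four_pow_le_totalWeight (hu0 : ∀ k, 0 < u k) :
    ∑ k ∈ Finset.Ico m n, 4 ^ k * u k ^ s ≤ totalWeight s u m n :=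
  Finset.sum_le_sum fun k _ => mul_le_mul_of_nonneg_right
    (by exact_mod_cast four_pow_le_card_dyadicFractions k) (Real.rpow_nonneg (hu0 k).le _)

theorem levelDensity_coeff_nonneg (hu0 : ∀ k, 0 < u k) (k : ℕ) :
    0 ≤ u k ^ (s - 1) / totalWeight s u m n :=
  div_nonneg (Real.rpow_nonneg (hu0 k).le _) (totalWeight_nonneg hu0)

theorem levelDensity_measurable (T : ℕ → Finset (Σ _ : ℕ, ℕ)) :
    Measurable (levelDensity s u m n T) :=
  Finset.measurable_fun_sum _ fun _ _ => (overlap_measurable _ _).const_mul _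

theorem levelDensity_nonneg (hu0 : ∀ k, 0 < u k) (T : ℕ → Finset (Σ _ : ℕ, ℕ)) (x : ℝ) :
    0 ≤ levelDensity s u m n T x :=
  Finset.sum_nonneg fun k _ => mul_nonneg (levelDensity_coeff_nonneg hu0 k) (overlap_nonneg _ _ _)

theorem levelDensity_mono (hu0 : ∀ k, 0 < u k) {T U : ℕ → Finset (Σ _ : ℕ, ℕ)}
    (h : ∀ k, T k ⊆ U k) (x : ℝ) : levelDensity s u m n T x ≤ levelDensity s u m n U x :=
  Finset.sum_le_sum fun k _ => mul_le_mul_of_nonneg_left (overlap_mono (h k) _ _)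
    (levelDensity_coeff_nonneg hu0 k)

theorem levelDensity_bdd (T : ℕ → Finset (Σ _ : ℕ, ℕ)) :
    ∃ B, ∀ x, |levelDensity s u m n T x| ≤ B := by
  choose B hB using fun k => overlap_bdd (T k) (u k)
  refine ⟨∑ k ∈ Finset.Ico m n, |u k ^ (s - 1) / totalWeight s u m n| * B k, fun x => ?_⟩
  refine (Finset.abs_sum_le_sum_abs _ _).trans (Finset.sum_le_sum fun k _ => ?_)
  rw [abs_mul]
  exact mul_le_mul_of_nonneg_left (hB k x) (abs_nonneg _)

theorem overlap_integrableOn (t : Finset (Σ _ : ℕ, ℕ)) (r a b : ℝ) :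
    IntegrableOn (overlap t r) (Icc a b) :=
  integrableOn_Icc_of_bounded (overlap_measurable _ _) (overlap_bdd _ _) a b

theorem abs_integral_levelDensity_sub_one_le (hu0 : ∀ k, 0 < u k)
    (hum : ∀ k, m ≤ k → u k * 2 ^ (k + 1) ≤ 1) (hS : 0 < totalWeight s u m n)
    {a b : ℝ} (ha : a ∈ Icc (0 : ℝ) 1) (hb : b ∈ Icc (0 : ℝ) 1) :
    |∫ x in Icc a b, (levelDensity s u m n dyadicFractions x - 1)| ≤ 2 / 2 ^ m := by
  set S := totalWeight s u m n with hSdef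
  have hpow : ∀ k, u k ^ (s - 1) * u k = u k ^ s := fun k => by
    rw [← Real.rpow_add_one (hu0 k).ne', sub_add_cancel]
  have e : ∀ x, levelDensity s u m n dyadicFractions x - 1 = ∑ k ∈ Finset.Ico m n,
      u k ^ (s - 1) / S * (overlap (dyadicFractions k) (u k) x
        - (dyadicFractions k).card * u k) := by
    intro x
    have h1 : ∑ k ∈ Finset.Ico m n, u k ^ (s - 1) / S * ((dyadicFractions k).card * u k) = 1 := by
      calc _ = (∑ k ∈ Finset.Ico m n, (dyadicFractions k).card * u k ^ s) / S := by
            rw [Finset.sum_div]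
            refine Finset.sum_congr rfl fun k _ => ?_
            rw [← hpow]; ring
        _ = 1 := div_self hS.ne'
    simp only [mul_sub, Finset.sum_sub_distrib, h1]
    rfl
  simp only [e]
  rw [integral_finsetSum _ fun k _ => Integrable.const_mul
    (Integrable.sub' (overlap_integrableOn _ _ a b) (integrableOn_const (by simp))) _]
  calc _ ≤ ∑ k ∈ Finset.Ico m n, (u k ^ (s - 1) / S) * (2 * 2 ^ k * u k) := by
        refine (Finset.abs_sum_le_sum_abs _ _).trans (Finset.sum_le_sum fun k hk => ?_)
        rw [integral_const_mul, abs_mul, abs_of_nonneg (levelDensity_coeff_nonneg hu0 k)]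
        exact mul_le_mul_of_nonneg_left (abs_integral_overlap_sub_le (hu0 k).le
          (hum k (Finset.mem_Ico.1 hk).1) ha hb) (levelDensity_coeff_nonneg hu0 k)
    _ ≤ ∑ k ∈ Finset.Ico m n, (2 / 2 ^ m / S) * ((dyadicFractions k).card * u k ^ s) := by
        refine Finset.sum_le_sum fun k hk => ?_
        have h1 : (2 : ℝ) ^ m ≤ 2 ^ k :=
          pow_le_pow_right₀ (by norm_num) (Finset.mem_Ico.1 hk).1
        have h2 : (2 : ℝ) ^ k * 2 ^ k ≤ (dyadicFractions k).card := by
          rw [← mul_pow]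
          norm_num
          exact_mod_cast four_pow_le_card_dyadicFractions k
        have h3 : (2 : ℝ) ^ k ≤ (dyadicFractions k).card / 2 ^ m := by
          rw [le_div_iff₀ (by positivity)]
          exact (mul_le_mul_of_nonneg_left h1 (by positivity)).trans h2
        have h4 : 0 ≤ u k ^ s := Real.rpow_nonneg (hu0 k).le _
        calc (u k ^ (s - 1) / S) * (2 * 2 ^ k * u k) = 2 / S * u k ^ s * 2 ^ k := by
              rw [← hpow]; ring
          _ ≤ 2 / S * u k ^ s * ((dyadicFractions k).card / 2 ^ m) :=
              mul_le_mul_of_nonneg_left h3 (by positivity)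
          _ = _ := by ring
    _ = 2 / 2 ^ m := by
        rw [← Finset.mul_sum, ← totalWeight, ← hSdef, div_mul_cancel₀ _ hS.ne']

theorem integral_levelDensity_sub_le (hu0 : ∀ k, 0 < u k) (hS : 0 < totalWeight s u m n) (D : ℕ) :
    ∫ x in Icc 0 1, (levelDensity s u m n dyadicFractions x
      - levelDensity s u m n (almostReduced · D) x) ≤ 8 / (D + 1) := by
  set S := totalWeight s u m n with hSdef
  have hpow : ∀ k, u k ^ (s - 1) * u k = u k ^ s := fun k => by
    rw [← Real.rpow_add_one (hu0 k).ne', sub_add_cancel]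
  simp only [levelDensity, ← Finset.sum_sub_distrib, ← mul_sub]
  rw [integral_finsetSum _ fun k _ => Integrable.const_mul
    (Integrable.sub' (overlap_integrableOn _ _ 0 1) (overlap_integrableOn _ _ 0 1)) _]
  calc _ ≤ ∑ k ∈ Finset.Ico m n, (8 / (D + 1) / S) * ((dyadicFractions k).card * u k ^ s) := by
        refine Finset.sum_le_sum fun k hk => ?_
        rw [integral_const_mul]
        refine (mul_le_mul_of_nonneg_left (integral_overlap_sub_almostReduced_le k D (hu0 k).le)
          (levelDensity_coeff_nonneg hu0 k)).trans (le_of_eq ?_)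
        rw [← hpow, ← hSdef]; ring
    _ = _ := by rw [← Finset.mul_sum, ← totalWeight, ← hSdef, div_mul_cancel₀ _ hS.ne']

theorem four_pow_mul_le (hu : ∀ k, u (k + 1) ≤ u k / 4) (k : ℕ) : 4 ^ k * u k ≤ u 0 := by
  induction k with
  | zero => simp
  | succ k ih =>
    refine le_trans ?_ ih
    rw [pow_succ, mul_assoc]
    refine mul_le_mul_of_nonneg_left ?_ (by positivity)
    linarith [hu k]

theorem exists_integral_levelDensity_le (hs : s ∈ Ioo (0 : ℝ) 1) (hu0 : ∀ k, 0 < u k)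
    (hu : ∀ k, u (k + 1) ≤ u k / 4) :
    ∃ C, 0 < C ∧ ∀ m n D : ℕ, 0 < totalWeight s u m n → ∀ a b : ℝ, a ≤ b →
      ∫ x in Icc a b, levelDensity s u m n (almostReduced · D) x
        ≤ D * (4 * (b - a) + C / totalWeight s u m n * (b - a) ^ s) := by
  obtain ⟨C, hC, H⟩ := exists_sum_rpow_mul_min_le hs hu0 hu
  refine ⟨(1 + 4 * u 0) * C, by have := hu0 0; positivity, fun m n D hS a b hab => ?_⟩
  set S := totalWeight s u m n with hSdef
  have hρ : 0 ≤ b - a := sub_nonneg.2 hab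
  set ρ := b - a with hρdef
  have hpow : ∀ k, u k ^ (s - 1) * u k = u k ^ s := fun k => by
    rw [← Real.rpow_add_one (hu0 k).ne', sub_add_cancel]
  simp only [levelDensity]
  rw [integral_finsetSum _ fun k _ => (overlap_integrableOn _ _ a b).const_mul _]
  calc _ ≤ ∑ k ∈ Finset.Ico m n, (D / S * (1 + 4 * u 0) * (u k ^ (s - 1) * min (u k) ρ)
          + D / S * (4 * ρ) * (4 ^ k * u k ^ s)) := by
        refine Finset.sum_le_sum fun k _ => ?_
        rw [integral_const_mul]
        refine (mul_le_mul_of_nonneg_left (integral_overlap_almostReduced_le k D (hu0 k).le hab)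
          (levelDensity_coeff_nonneg hu0 k)).trans ?_
        rw [← hSdef, ← hρdef]
        have h1 : (1 + 4 ^ (k + 1) * (ρ + u k)) * min (u k) ρ
            ≤ (1 + 4 * u 0) * min (u k) ρ + 4 * ρ * (4 ^ k * u k) := by
          have h2 := four_pow_mul_le hu k
          have h3 : 0 ≤ min (u k) ρ := le_min (hu0 k).le hρ
          have h4 := min_le_left (u k) ρ
          have h5 : 0 ≤ 4 * ρ * 4 ^ k := by positivity
          rw [pow_succ]
          nlinarith [mul_le_mul_of_nonneg_left h4 h5, mul_le_mul_of_nonneg_right h2 h3]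
        have h6 : 0 ≤ u k ^ (s - 1) * (D / S) :=
          mul_nonneg (Real.rpow_nonneg (hu0 k).le _) (by positivity)
        refine (le_of_eq ?_).trans ((mul_le_mul_of_nonneg_left h1 h6).trans (le_of_eq ?_))
        · ring
        · rw [← hpow]; ring
    _ = D / S * (1 + 4 * u 0) * (∑ k ∈ Finset.Ico m n, u k ^ (s - 1) * min (u k) ρ)
          + D / S * (4 * ρ) * ∑ k ∈ Finset.Ico m n, 4 ^ k * u k ^ s := by
        rw [Finset.sum_add_distrib, Finset.mul_sum, Finset.mul_sum]
    _ ≤ D / S * (1 + 4 * u 0) * (C * ρ ^ s) + D / S * (4 * ρ) * S := by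
        have hu00 := hu0 0
        refine add_le_add (mul_le_mul_of_nonneg_left ?_ (by positivity))
          (mul_le_mul_of_nonneg_left (sum_four_pow_le_totalWeight hu0) (by positivity))
        refine le_trans (Finset.sum_le_sum_of_subset_of_nonneg (t := Finset.range n) ?_ ?_)
          (H ρ hρ n)
        · intro k hk
          exact Finset.mem_range.2 (Finset.mem_Ico.1 hk).2
        · intro k _ _
          exact mul_nonneg (Real.rpow_nonneg (hu0 k).le _) (le_min (hu0 k).le hρ)
    _ = _ := by field_simp; ring

end levelDensity

/-- A density `f` on `[0, 1]`, carried by the compact set `F`, of mass more than `1 / 2` and giving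
mass at most a constant less than `A₀` times `(b - a) ^ s` to intervals `[a, b]` of length at
most `δ`. -/
structure IsFrostmanDensity (s δ A₀ : ℝ) (f : ℝ → ℝ) (F : Set ℝ) : Prop where
  isClosed : IsClosed F
  subset : F ⊆ Icc 0 1
  isTame : IsTame f
  eq_zero : ∀ x, x ∉ F → f x = 0
  mass : 1 / 2 < ∫ x in Icc 0 1, f x
  growth : ∃ A, 0 < A ∧ A < A₀ ∧ ∀ a b, a ∈ Icc (0 : ℝ) 1 → b ∈ Icc (0 : ℝ) 1 → a ≤ b →
    b - a ≤ δ → ∫ x in Icc a b, f x ≤ A * (b - a) ^ s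

theorem exists_le_mul_rpow {s : ℝ} (hs : s ∈ Ioo (0 : ℝ) 1) {X : ℝ} (hX : 0 < X) :
    ∃ ρ₀, 0 < ρ₀ ∧ ∀ ρ, 0 ≤ ρ → ρ ≤ ρ₀ → ρ ≤ X * ρ ^ s := by
  have h1s : 0 < 1 - s := by linarith [hs.2]
  refine ⟨X ^ (1 - s)⁻¹, by positivity, fun ρ hρ hle => ?_⟩
  rcases hρ.eq_or_lt with rfl | hρ
  · rw [Real.zero_rpow hs.1.ne', mul_zero]
  have h : ρ ^ (1 - s) ≤ X := by
    calc ρ ^ (1 - s) ≤ (X ^ (1 - s)⁻¹) ^ (1 - s) := Real.rpow_le_rpow hρ.le hle h1s.le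
      _ = X := by rw [← Real.rpow_mul hX.le, inv_mul_cancel₀ h1s.ne', Real.rpow_one]
  calc ρ = ρ ^ (1 - s) * ρ ^ s := by rw [← Real.rpow_add hρ]; simp
    _ ≤ X * ρ ^ s := mul_le_mul_of_nonneg_right h (by positivity)

theorem isFrostmanDensity_Icc {s : ℝ} (hs : s ∈ Ioo (0 : ℝ) 1) {A₀ : ℝ} (hA₀ : 0 < A₀) :
    ∃ δ, 0 < δ ∧ IsFrostmanDensity s δ A₀ ((Icc (0 : ℝ) 1).indicator fun _ => 1) (Icc 0 1) := by
  obtain ⟨δ, hδ, H⟩ := exists_le_mul_rpow hs (half_pos hA₀)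
  refine ⟨δ, hδ, isClosed_Icc, Subset.rfl, IsTame.one.indicator (by simp) (by simp),
    fun x hx => indicator_of_notMem hx _, ?_, A₀ / 2, half_pos hA₀, half_lt_self hA₀, ?_⟩
  · rw [setIntegral_indicator measurableSet_Icc]
    norm_num
  · intro a b ha hb hab hd
    rw [setIntegral_indicator measurableSet_Icc,
      inter_eq_self_of_subset_left (Icc_subset_Icc ha.1 hb.2)]
    simp only [setIntegral_const, Real.volume_real_Icc_of_le hab, smul_eq_mul, mul_one]
    exact H _ (sub_nonneg.2 hab) hd

theorem Icc_subset_unit_of_mem_dyadicFractions {k : ℕ} {i : Σ _ : ℕ, ℕ}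
    (hi : i ∈ dyadicFractions k) {r : ℝ} (hr : 0 ≤ r) (hrk : r * 2 ^ (k + 1) ≤ 1) :
    (i.2 : ℝ) / i.1 ∈ Icc (0 : ℝ) 1 ∧ (i.2 : ℝ) / i.1 + r ∈ Icc (0 : ℝ) 1 := by
  obtain ⟨⟨h1, h2⟩, h3⟩ := mem_dyadicFractions.1 hi
  have hq : (0 : ℝ) < i.1 := by exact_mod_cast lt_of_lt_of_le (by positivity) h1
  have h2' : (i.1 : ℝ) ≤ 2 ^ (k + 1) := by exact_mod_cast h2.le
  have h3' : (i.2 : ℝ) + 1 ≤ i.1 := by exact_mod_cast h3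
  have h4 : r ≤ 1 / i.1 := by
    rw [le_div_iff₀ hq]
    exact (mul_le_mul_of_nonneg_left h2' hr).trans hrk
  have h5 : 0 ≤ (i.2 : ℝ) / i.1 := by positivity
  have h6 : (i.2 : ℝ) / i.1 + 1 / i.1 ≤ 1 := by
    rw [← add_div, div_le_one hq]; exact h3'
  exact ⟨⟨h5, by linarith⟩, by linarith, by linarith⟩

theorem exists_forall_mul_two_pow_le {u : ℕ → ℝ} (hu : ∀ k, u (k + 1) ≤ u k / 4)
    {ε : ℝ} (hε : 0 < ε) : ∃ m, ∀ k, m ≤ k → u k * 2 ^ (k + 1) ≤ ε := by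
  obtain ⟨m, hm⟩ := pow_unbounded_of_one_lt (2 * u 0 / ε) (one_lt_two)
  refine ⟨m, fun k hk => ?_⟩
  have h1 : (2 : ℝ) ^ m ≤ 2 ^ k := pow_le_pow_right₀ (by norm_num) hk
  have h2 := four_pow_mul_le hu k
  have h3 : (4 : ℝ) ^ k = 2 ^ k * 2 ^ k := by rw [← mul_pow]; norm_num
  rw [div_lt_iff₀ hε] at hm
  rw [h3] at h2
  have h4 : 2 * u 0 ≤ 2 ^ k * ε := hm.le.trans (mul_le_mul_of_nonneg_right h1 hε.le)
  have h5 : (0 : ℝ) < 2 ^ k := by positivity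
  refine le_of_mul_le_mul_left ?_ h5
  rw [pow_succ]
  linarith

theorem exists_le_totalWeight {s : ℝ} {u : ℕ → ℝ} (hu0 : ∀ k, 0 < u k)
    (hdiv : ¬ Summable fun k : ℕ => (4 : ℝ) ^ k * u k ^ s) (m : ℕ) (R : ℝ) :
    ∃ n, R ≤ totalWeight s u m n := by
  rw [not_summable_iff_tendsto_nat_atTop_of_nonneg fun k =>
    mul_nonneg (by positivity) (Real.rpow_nonneg (hu0 k).le _)] at hdiv
  obtain ⟨n, hn, hmn⟩ := ((hdiv.eventually_ge_atTop
    (R + ∑ k ∈ Finset.range m, (4 : ℝ) ^ k * u k ^ s)).and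
      (Filter.eventually_ge_atTop m)).exists
  refine ⟨n, le_trans ?_ (sum_four_pow_le_totalWeight hu0)⟩
  rw [Finset.sum_Ico_eq_sub _ hmn]
  linarith

theorem IsFrostmanDensity.exists_refinement {s δ A₀ : ℝ} {f : ℝ → ℝ} {F : Set ℝ}
    (h : IsFrostmanDensity s δ A₀ f F) (hs : s ∈ Ioo (0 : ℝ) 1) {u : ℕ → ℝ}
    (hu0 : ∀ k, 0 < u k) (hu : ∀ k, u (k + 1) ≤ u k / 4)
    (hdiv : ¬ Summable fun k : ℕ => (4 : ℝ) ^ k * u k ^ s) (N : ℕ) :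
    ∃ f' F', IsFrostmanDensity s δ A₀ f' F' ∧ F' ⊆ F ∧ ∀ x ∈ F', ∃ k, N ≤ k ∧
      ∃ i ∈ dyadicFractions k, x ∈ Icc ((i.2 : ℝ) / i.1) (i.2 / i.1 + u k) := by
  obtain ⟨A, hA, hAA₀, hgrow⟩ := h.growth
  obtain ⟨M, hM0, hM⟩ : ∃ M, 0 < M ∧ ∀ x, f x ≤ M := by
    obtain ⟨M, hM⟩ := h.isTame.bdd
    exact ⟨max M 1, by positivity, fun x => (hM x).trans (le_max_left _ _)⟩
  obtain ⟨K, hK, hdisc⟩ := h.isTame.disc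
  obtain ⟨C, hC, hfrost⟩ := exists_integral_levelDensity_le hs hu0 hu
  set I := ∫ x in Icc 0 1, f x with hI
  have hgap : 0 < I - 1 / 2 := sub_pos.2 h.mass
  obtain ⟨D, hD⟩ := exists_nat_gt (M * 8 / ((I - 1 / 2) / 2))
  have hD : M * (8 / (D + 1)) < (I - 1 / 2) / 2 := by
    rw [div_lt_iff₀ (half_pos hgap)] at hD
    rw [← mul_div_assoc, div_lt_iff₀ (by positivity)]
    linarith
  obtain ⟨ρ₀, hρ₀, hsmall⟩ := exists_le_mul_rpow hs
    (show 0 < A / (8 * M * (D + 1)) by positivity)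
  have hρ₀s : 0 < ρ₀ ^ s := Real.rpow_pos_of_pos hρ₀ s
  set τ := min ((I - 1 / 2) / 2) ((A₀ - A) / 2 * ρ₀ ^ s) with hτ
  have hτ0 : 0 < τ := lt_min (half_pos hgap) (mul_pos (by linarith) hρ₀s)
  obtain ⟨m, hNm, hmu, hmτ⟩ : ∃ m, N ≤ m ∧ (∀ k, m ≤ k → u k * 2 ^ (k + 1) ≤ 1) ∧
      K * (2 / 2 ^ m) ≤ τ := by
    obtain ⟨m₁, h₁⟩ := exists_forall_mul_two_pow_le hu one_pos
    obtain ⟨m₂, h₂⟩ := pow_unbounded_of_one_lt (K * 2 / τ) (one_lt_two)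
    refine ⟨max N (max m₁ m₂), le_max_left _ _, fun k hk =>
      h₁ k ((le_max_left m₁ m₂).trans ((le_max_right _ _).trans hk)), ?_⟩
    rw [div_lt_iff₀ hτ0] at h₂
    rw [← mul_div_assoc, div_le_iff₀ (by positivity), mul_comm τ]
    refine h₂.le.trans (mul_le_mul_of_nonneg_right (pow_le_pow_right₀ (by norm_num) ?_) hτ0.le)
    exact (le_max_right m₁ m₂).trans (le_max_right _ _)
  obtain ⟨n, hn⟩ := exists_le_totalWeight hu0 hdiv m (2 * M * (D + 1) * C / A)
  have hS : 0 < totalWeight s u m n := lt_of_lt_of_le (by positivity) hn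
  set G := levelDensity s u m n dyadicFractions with hG
  set g := levelDensity s u m n (almostReduced · D) with hg
  have hgG : ∀ x, g x ≤ G x := levelDensity_mono hu0 fun k => almostReduced_subset k D
  have hg0 : ∀ x, 0 ≤ g x := levelDensity_nonneg hu0 _
  have hGm : Measurable G := levelDensity_measurable _
  have hgm : Measurable g := levelDensity_measurable _
  have hGb : ∃ B, ∀ x, |G x| ≤ B := levelDensity_bdd _
  have hgb : ∃ B, ∀ x, |g x| ≤ B := levelDensity_bdd _
  have hG1b : ∃ B, ∀ x, |G x - 1| ≤ B := by
    obtain ⟨B, hB⟩ := hGb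
    exact ⟨B + |1|, fun x => (abs_sub _ _).trans (add_le_add (hB x) le_rfl)⟩
  have hfg := h.isTame.integrableOn_mul hgm hgb
  have hfG := h.isTame.integrableOn_mul hGm hGb
  have hf := h.isTame.integrableOn
  have hfG1 : ∀ a b, a ∈ Icc (0 : ℝ) 1 → b ∈ Icc (0 : ℝ) 1 →
      |(∫ x in Icc a b, f x * G x) - ∫ x in Icc a b, f x| ≤ τ := by
    intro a b ha hb
    rw [← integral_sub (hfG a b) (hf a b)]
    refine le_trans (le_of_eq ?_) ((hdisc (fun x => G x - 1) (2 / 2 ^ m) (hGm.sub_const 1) hG1b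
      (fun a b ha hb => abs_integral_levelDensity_sub_one_le hu0 hmu hS ha hb) a b ha hb).trans hmτ)
    simp only [mul_sub, mul_one]
  refine ⟨fun x => f x * g x, F ∩ ⋃ k ∈ Finset.Ico m n, ⋃ i ∈ almostReduced k D,
    Icc ((i.2 : ℝ) / i.1) (i.2 / i.1 + u k), ⟨?_, ?_, ?_, ?_, ?_, ?_⟩, inter_subset_left, ?_⟩
  · exact h.isClosed.inter (isClosed_biUnion_finset fun k _ => isClosed_biUnion_finset fun i _ =>
      isClosed_Icc)
  · exact inter_subset_left.trans h.subset
  · have e : (fun x => f x * g x) = fun x => ∑ k ∈ Finset.Ico m n, ∑ i ∈ almostReduced k D,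
        u k ^ (s - 1) / totalWeight s u m n *
          (Icc ((i.2 : ℝ) / i.1) (i.2 / i.1 + u k)).indicator f x := by
      ext x
      simp only [hg, levelDensity, overlap, Finset.mul_sum]
      refine Finset.sum_congr rfl fun k _ => Finset.sum_congr rfl fun i _ => ?_
      by_cases hx : x ∈ Icc ((i.2 : ℝ) / i.1) (i.2 / i.1 + u k)
      · simp [hx, mul_comm]
      · simp [hx]
    rw [e]
    refine IsTame.sum _ fun k hk => IsTame.sum _ fun i hi =>
      IsTame.const_mul ?_ (levelDensity_coeff_nonneg hu0 k)
    have := Icc_subset_unit_of_mem_dyadicFractions (almostReduced_subset k D hi) (hu0 k).le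
      (hmu k (Finset.mem_Ico.1 hk).1)
    exact h.isTame.indicator this.1 this.2
  · intro x hx
    by_cases hxF : x ∈ F
    · have hx : g x = 0 := by
        refine Finset.sum_eq_zero fun k hk => ?_
        rw [overlap, Finset.sum_eq_zero fun i hi => ?_, mul_zero]
        refine indicator_of_notMem (fun hxi => hx ⟨hxF, ?_⟩) _
        exact mem_biUnion hk (mem_biUnion hi hxi)
      rw [hx, mul_zero]
    · rw [h.eq_zero x hxF, zero_mul]
  · have h1 := (abs_le.1 (hfG1 0 1 (by simp) (by simp))).1
    have h2 : (∫ x in Icc 0 1, f x * G x) - ∫ x in Icc 0 1, f x * g x ≤ M * (8 / (D + 1)) := by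
      rw [← integral_sub (hfG 0 1) (hfg 0 1)]
      have hsub : IntegrableOn (fun x => G x - g x) (Icc 0 1) :=
        Integrable.sub' (integrableOn_Icc_of_bounded hGm hGb 0 1)
          (integrableOn_Icc_of_bounded hgm hgb 0 1)
      calc _ ≤ ∫ x in Icc 0 1, M * (G x - g x) := by
            refine integral_mono (Integrable.sub' (hfG 0 1) (hfg 0 1)) (hsub.const_mul M)
              fun x => ?_
            dsimp only
            rw [← mul_sub]
            exact mul_le_mul_of_nonneg_right (hM x) (sub_nonneg.2 (hgG x))
        _ ≤ _ := by
            rw [integral_const_mul]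
            exact mul_le_mul_of_nonneg_left (integral_levelDensity_sub_le hu0 hS D) hM0.le
    have h3 : τ ≤ (I - 1 / 2) / 2 := min_le_left _ _
    linarith
  · refine ⟨(A + A₀) / 2, by linarith, by linarith, fun a b ha hb hab hδ => ?_⟩
    have hρ : 0 ≤ b - a := sub_nonneg.2 hab
    have hρs : 0 ≤ (b - a) ^ s := Real.rpow_nonneg hρ s
    rcases le_or_gt (b - a) ρ₀ with hle | hgt
    · have h1 : ∫ x in Icc a b, f x * g x ≤ M * ∫ x in Icc a b, g x := by
        rw [← integral_const_mul]
        exact integral_mono (hfg a b)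
          ((integrableOn_Icc_of_bounded hgm hgb a b).const_mul M)
          fun x => mul_le_mul_of_nonneg_right (hM x) (hg0 x)
      have h2 := hfrost m n D hS a b hab
      have h3 := hsmall _ hρ hle
      have h4 : C / totalWeight s u m n ≤ A / (2 * M * (D + 1)) := by
        rw [div_le_iff₀ hA] at hn
        rw [div_le_div_iff₀ hS (by positivity)]
        linarith
      calc ∫ x in Icc a b, f x * g x
          ≤ M * (D * (4 * (b - a) + C / totalWeight s u m n * (b - a) ^ s)) :=
            h1.trans (mul_le_mul_of_nonneg_left h2 hM0.le)
        _ ≤ M * ((D + 1) * (4 * (A / (8 * M * (D + 1)) * (b - a) ^ s)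
              + A / (2 * M * (D + 1)) * (b - a) ^ s)) := by
            gcongr
            linarith
        _ = A * (b - a) ^ s := by field_simp; ring
        _ ≤ _ := mul_le_mul_of_nonneg_right (by linarith) hρs
    · have h1 : ∫ x in Icc a b, f x * g x ≤ ∫ x in Icc a b, f x * G x :=
        integral_mono (hfg a b) (hfG a b) fun x =>
          mul_le_mul_of_nonneg_left (hgG x) (h.isTame.nonneg x)
      have h2 := (abs_le.1 (hfG1 a b ha hb)).2
      have h3 := hgrow a b ha hb hab hδ
      have h4 : τ ≤ (A₀ - A) / 2 * (b - a) ^ s :=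
        (min_le_right _ _).trans (mul_le_mul_of_nonneg_left
          (Real.rpow_le_rpow hρ₀.le hgt.le hs.1.le) (by linarith))
      linarith
  · rintro x ⟨-, hx⟩
    simp only [mem_iUnion] at hx
    obtain ⟨k, hk, i, hi, hxi⟩ := hx
    exact ⟨k, hNm.trans (Finset.mem_Ico.1 hk).1, i, almostReduced_subset k D hi, hxi⟩

theorem exists_Ioo_superset {s : ℝ} (hs : s ∈ Ioo (0 : ℝ) 1) {δ : ℝ} (hδ : 0 < δ)
    {κ : NNReal} (hκ : 0 < κ) {t : Set ℝ} (ht : Metric.ediam t ≤ ENNReal.ofReal (δ / 4)) :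
    ∃ a b, a ≤ b ∧ b - a ≤ δ ∧ t ⊆ Ioo a b ∧
      ENNReal.ofReal ((b - a) ^ s) ≤ 2 * (⨆ _ : t.Nonempty, Metric.ediam t ^ s) + κ := by
  rcases t.eq_empty_or_nonempty with rfl | hne
  · exact ⟨0, 0, le_rfl, by simpa using hδ.le, by simp, by simp [Real.zero_rpow hs.1.ne']⟩
  obtain ⟨x, hx⟩ := hne
  set d := (Metric.ediam t).toReal with hd
  have hfin : Metric.ediam t ≠ ⊤ := ne_top_of_le_ne_top ENNReal.ofReal_ne_top ht
  have hd0 : 0 ≤ d := ENNReal.toReal_nonneg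
  have hdδ : d ≤ δ / 4 := ENNReal.toReal_le_of_le_ofReal (by positivity) ht
  have hκ' : (0 : ℝ) < κ := hκ
  set e := min (δ / 2) ((κ : ℝ) ^ s⁻¹) with he
  have he0 : 0 < e := lt_min (half_pos hδ) (by positivity)
  have heδ : e ≤ δ / 2 := min_le_left _ _
  have hes : e ^ s ≤ κ := by
    calc e ^ s ≤ ((κ : ℝ) ^ s⁻¹) ^ s := Real.rpow_le_rpow he0.le (min_le_right _ _) hs.1.le
      _ = κ := by rw [← Real.rpow_mul hκ'.le, inv_mul_cancel₀ hs.1.ne', Real.rpow_one]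
  refine ⟨x - d - e / 2, x + d + e / 2, by linarith, by linarith, fun y hy => ?_, ?_⟩
  · have h1 : dist y x ≤ d := by
      rw [hd, ← ENNReal.ofReal_le_iff_le_toReal hfin, ← edist_dist]
      exact Metric.edist_le_ediam_of_mem hy hx
    rw [Real.dist_eq, abs_le] at h1
    constructor <;> linarith
  · have h2 : (x + d + e / 2 - (x - d - e / 2)) ^ s ≤ 2 * d ^ s + κ := by
      calc (x + d + e / 2 - (x - d - e / 2)) ^ s = (2 * d + e) ^ s := by congr 1; ring
        _ ≤ (2 * d) ^ s + e ^ s :=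
            Real.rpow_add_le_add_rpow (by positivity) he0.le hs.1.le hs.2.le
        _ ≤ 2 * d ^ s + κ := by
            refine add_le_add ?_ hes
            rw [Real.mul_rpow (by norm_num) hd0]
            refine mul_le_mul_of_nonneg_right ?_ (by positivity)
            calc (2 : ℝ) ^ s ≤ 2 ^ (1 : ℝ) :=
                  Real.rpow_le_rpow_of_exponent_le (by norm_num) hs.2.le
              _ = 2 := Real.rpow_one 2
    refine (ENNReal.ofReal_le_ofReal h2).trans ?_
    rw [ENNReal.ofReal_add (by positivity) hκ'.le, ENNReal.ofReal_mul (by norm_num),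
      ← ENNReal.ofReal_rpow_of_nonneg hd0 hs.1.le, hd, ENNReal.ofReal_toReal hfin,
      ENNReal.ofReal_coe_nnreal, ENNReal.ofReal_ofNat]
    refine add_le_add (mul_le_mul_right ?_ _) le_rfl
    exact le_iSup_of_le (⟨x, hx⟩ : t.Nonempty) le_rfl

theorem IsFrostmanDensity.half_le_sum {s δ A₀ : ℝ} {f : ℝ → ℝ} {F : Set ℝ}
    (h : IsFrostmanDensity s δ A₀ f F) (hs : 0 < s) {ι : Type*} (T : Finset ι) {a b : ι → ℝ}
    (hab : ∀ i, a i ≤ b i) (hδ : ∀ i, b i - a i ≤ δ) (hF : F ⊆ ⋃ i ∈ T, Icc (a i) (b i)) :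
    1 / 2 ≤ A₀ * ∑ i ∈ T, (b i - a i) ^ s := by
  obtain ⟨A, hA, hAA₀, hgrow⟩ := h.growth
  have hint : ∀ i ∈ T, IntegrableOn ((Icc (a i) (b i)).indicator f) (Icc 0 1) := fun i _ =>
    (h.isTame.integrableOn 0 1).indicator measurableSet_Icc
  have hpt : ∀ x, f x ≤ ∑ i ∈ T, (Icc (a i) (b i)).indicator f x := by
    intro x
    have hnn : ∀ i ∈ T, 0 ≤ (Icc (a i) (b i)).indicator f x := fun i _ =>
      indicator_nonneg (fun x _ => h.isTame.nonneg x) x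
    by_cases hx : x ∈ F
    · obtain ⟨i, hi, hxi⟩ : ∃ i ∈ T, x ∈ Icc (a i) (b i) := by
        simpa only [mem_iUnion, exists_prop] using hF hx
      calc f x = (Icc (a i) (b i)).indicator f x := (indicator_of_mem hxi f).symm
        _ ≤ _ := Finset.single_le_sum hnn hi
    · rw [h.eq_zero x hx]
      exact Finset.sum_nonneg hnn
  calc 1 / 2 ≤ ∫ x in Icc 0 1, f x := h.mass.le
    _ ≤ ∫ x in Icc 0 1, ∑ i ∈ T, (Icc (a i) (b i)).indicator f x :=
        integral_mono (h.isTame.integrableOn 0 1) (integrable_finsetSum _ hint) hpt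
    _ = ∑ i ∈ T, ∫ x in Icc 0 1, (Icc (a i) (b i)).indicator f x := integral_finsetSum _ hint
    _ ≤ ∑ i ∈ T, A₀ * (b i - a i) ^ s := by
        refine Finset.sum_le_sum fun i _ => ?_
        have hpos : 0 ≤ (b i - a i) ^ s := Real.rpow_nonneg (sub_nonneg.2 (hab i)) s
        rw [setIntegral_indicator measurableSet_Icc, Icc_inter_Icc]
        rcases le_or_gt (max 0 (a i)) (min 1 (b i)) with hle | hgt
        · have h1 : min 1 (b i) - max 0 (a i) ≤ b i - a i :=
            sub_le_sub (min_le_right _ _) (le_max_right _ _)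
          calc _ ≤ A * (min 1 (b i) - max 0 (a i)) ^ s :=
                hgrow _ _ ⟨le_max_left _ _, hle.trans (min_le_left _ _)⟩
                  ⟨(le_max_left _ _).trans hle, min_le_left _ _⟩ hle (h1.trans (hδ i))
            _ ≤ A₀ * (b i - a i) ^ s :=
                mul_le_mul hAA₀.le (Real.rpow_le_rpow (sub_nonneg.2 hle) h1 hs.le)
                  (Real.rpow_nonneg (sub_nonneg.2 hle) s) (hA.trans hAA₀).le
        · rw [Icc_eq_empty (not_le.2 hgt), Measure.restrict_empty, integral_zero_measure]
          exact mul_nonneg (hA.trans hAA₀).le hpos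
    _ = _ := by rw [Finset.mul_sum]

/-- If `∑ 4 ^ k * u k ^ s` diverges, the points lying for arbitrarily large `k` within `u k` to the
right of some `p / q` with `2 ^ k ≤ q < 2 ^ (k + 1)` have infinite `s`-dimensional measure. -/
theorem hausdorffMeasure_limsup_eq_top {s : ℝ} (hs : s ∈ Ioo (0 : ℝ) 1) {u : ℕ → ℝ}
    (hu0 : ∀ k, 0 < u k) (hu : ∀ k, u (k + 1) ≤ u k / 4)
    (hdiv : ¬ Summable fun k : ℕ => (4 : ℝ) ^ k * u k ^ s) :
    Measure.hausdorffMeasure s {x : ℝ | ∀ N, ∃ k, N ≤ k ∧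
      ∃ i ∈ dyadicFractions k, x ∈ Icc ((i.2 : ℝ) / i.1) (i.2 / i.1 + u k)} = ⊤ := by
  refine ENNReal.eq_top_of_forall_nnreal_le fun B => ?_
  set A₀ : ℝ := 1 / (2 * (2 * B + 1)) with hA₀
  have hA₀pos : 0 < A₀ := by positivity
  obtain ⟨δ, hδ, hinit⟩ := isFrostmanDensity_Icc hs hA₀pos
  have hstep : ∀ (N : ℕ) (P : {P : (ℝ → ℝ) × Set ℝ // IsFrostmanDensity s δ A₀ P.1 P.2}),
      ∃ P' : {P : (ℝ → ℝ) × Set ℝ // IsFrostmanDensity s δ A₀ P.1 P.2},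
        P'.1.2 ⊆ P.1.2 ∧ ∀ x ∈ P'.1.2, ∃ k, N ≤ k ∧
          ∃ i ∈ dyadicFractions k, x ∈ Icc ((i.2 : ℝ) / i.1) (i.2 / i.1 + u k) := by
    rintro N ⟨⟨f, F⟩, h⟩
    obtain ⟨f', F', h', hsub, hF'⟩ := h.exists_refinement hs hu0 hu hdiv N
    exact ⟨⟨⟨f', F'⟩, h'⟩, hsub, hF'⟩
  choose next hnext_sub hnext using hstep
  let P : ℕ → {P : (ℝ → ℝ) × Set ℝ // IsFrostmanDensity s δ A₀ P.1 P.2} :=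
    fun n => Nat.rec ⟨⟨_, _⟩, hinit⟩ next n
  have hcpct : ∀ n, IsCompact (P n).1.2 := fun n =>
    isCompact_Icc.of_isClosed_subset (P n).2.isClosed (P n).2.subset
  have hanti : Antitone fun n => (P n).1.2 := antitone_nat_of_succ_le fun n => hnext_sub n (P n)
  have hlim : ⋂ n, (P n).1.2 ⊆ {x : ℝ | ∀ N, ∃ k, N ≤ k ∧
      ∃ i ∈ dyadicFractions k, x ∈ Icc ((i.2 : ℝ) / i.1) (i.2 / i.1 + u k)} := fun x hx N =>
    hnext N (P N) x (mem_iInter.1 hx (N + 1))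
  rw [Measure.hausdorffMeasure_apply]
  refine le_iSup₂_of_le (ENNReal.ofReal (δ / 4)) (ENNReal.ofReal_pos.2 (by positivity)) ?_
  refine le_iInf fun t => le_iInf fun hcov => le_iInf fun hdiam => ?_
  obtain ⟨κ, hκ, hκsum⟩ := ENNReal.exists_pos_sum_of_countable one_ne_zero ℕ
  choose a b hab hbδ htsub hlen using fun n => exists_Ioo_superset hs hδ (hκ n) (hdiam n)
  have hopen : IsOpen (⋃ n, Ioo (a n) (b n)) := isOpen_iUnion fun n => isOpen_Ioo
  obtain ⟨n, hn⟩ := exists_subset_nhds_of_isCompact (U := ⋃ n, Ioo (a n) (b n))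
    hanti.directed_ge hcpct fun x hx =>
      hopen.mem_nhds (iUnion_mono htsub (hcov (hlim hx)))
  obtain ⟨T, hT⟩ := (hcpct n).elim_finite_subcover _ (fun n => isOpen_Ioo) hn
  have hsum := (P n).2.half_le_sum hs.1 T hab hbδ
    (hT.trans (iUnion₂_mono fun i _ => Ioo_subset_Icc_self))
  have hsum' : 2 * (B : ℝ) + 1 ≤ ∑ i ∈ T, (b i - a i) ^ s := by
    rw [hA₀, one_div_mul_eq_div, div_le_div_iff₀ (by norm_num) (by positivity)] at hsum
    linarith
  have hfinal : 2 * (B : ENNReal) + 1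
      ≤ 2 * (∑' n, ⨆ _ : (t n).Nonempty, Metric.ediam (t n) ^ s) + 1 := by
    calc 2 * (B : ENNReal) + 1 = ENNReal.ofReal (2 * (B : ℝ) + 1) := by
          rw [ENNReal.ofReal_add (by positivity) zero_le_one, ENNReal.ofReal_mul (by norm_num)]
          simp
      _ ≤ ENNReal.ofReal (∑ i ∈ T, (b i - a i) ^ s) := ENNReal.ofReal_le_ofReal hsum'
      _ = ∑ i ∈ T, ENNReal.ofReal ((b i - a i) ^ s) :=
          ENNReal.ofReal_sum_of_nonneg fun i _ => Real.rpow_nonneg (sub_nonneg.2 (hab i)) s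
      _ ≤ ∑ i ∈ T, (2 * (⨆ _ : (t i).Nonempty, Metric.ediam (t i) ^ s) + κ i) :=
          Finset.sum_le_sum fun i _ => hlen i
      _ ≤ ∑' i, (2 * (⨆ _ : (t i).Nonempty, Metric.ediam (t i) ^ s) + κ i) :=
          ENNReal.sum_le_tsum T
      _ = 2 * (∑' i, ⨆ _ : (t i).Nonempty, Metric.ediam (t i) ^ s) + ∑' i, (κ i : ENNReal) := by
          rw [ENNReal.tsum_add, ENNReal.tsum_mul_left]
      _ ≤ _ := add_le_add le_rfl hκsum.le
  have h2 := (ENNReal.add_le_add_iff_right ENNReal.one_ne_top).1 hfinal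
  exact (ENNReal.mul_le_mul_iff_right two_ne_zero ENNReal.ofNat_ne_top).1 h2

theorem not_summable_dyadic {Ψ : ℝ → ℝ} (hpos : ∀ t, 1 ≤ t → 0 < Ψ t)
    (hmono : ∀ s t : ℝ, 1 ≤ s → s ≤ t → Ψ s ≤ Ψ t) {s : ℝ} (hs : s ∈ Ioo (0 : ℝ) 1)
    (hdiv : ¬ Summable (fun t : ℕ => (t : ℝ) * (1 / ((t : ℝ) ^ 2 * Ψ t)) ^ s)) :
    ¬ Summable fun k : ℕ => (4 : ℝ) ^ k * (1 / (2 * (4 ^ (k + 1) * Ψ (2 ^ (k + 1))))) ^ s := by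
  set f : ℕ → ℝ := fun t => (t : ℝ) * (1 / ((t : ℝ) ^ 2 * Ψ t)) ^ s with hf
  have hΨ : ∀ k : ℕ, 0 < Ψ (2 ^ k) := fun k => hpos _ (one_le_pow₀ (by norm_num))
  have hf0 : ∀ t, 0 ≤ f t := by
    intro t
    rcases Nat.eq_zero_or_pos t with rfl | ht
    · simp [hf]
    · have := hpos t (by exact_mod_cast ht)
      positivity
  set v : ℕ → ℝ := fun k => (4 : ℝ) ^ k * (1 / (2 * (4 ^ (k + 1) * Ψ (2 ^ (k + 1))))) ^ s with hv
  have hv0 : ∀ k, 0 ≤ v k := fun k => by have := hΨ (k + 1); positivity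
  have hblock : ∀ k, ∑ t ∈ Finset.Ico (2 ^ (k + 1)) (2 ^ (k + 2)), f t ≤ 16 * v k := by
    intro k
    have hΨk := hΨ (k + 1)
    set y := 1 / (2 * (4 ^ (k + 1) * Ψ (2 ^ (k + 1)))) with hy
    have hy0 : 0 < y := by positivity
    calc _ ≤ ∑ t ∈ Finset.Ico (2 ^ (k + 1)) (2 ^ (k + 2)), (2 : ℝ) ^ (k + 2) * (2 * y ^ s) := by
          refine Finset.sum_le_sum fun t ht => ?_
          rw [Finset.mem_Ico] at ht
          have h1 : (2 : ℝ) ^ (k + 1) ≤ t := by exact_mod_cast ht.1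
          have h2 : (t : ℝ) ≤ 2 ^ (k + 2) := by exact_mod_cast ht.2.le
          have h3 : (4 : ℝ) ^ (k + 1) ≤ (t : ℝ) ^ 2 := by
            calc (4 : ℝ) ^ (k + 1) = (2 ^ (k + 1)) ^ 2 := by
                  rw [← pow_mul, mul_comm, pow_mul]; norm_num
              _ ≤ _ := pow_le_pow_left₀ (by positivity) h1 2
          have h4 : Ψ (2 ^ (k + 1)) ≤ Ψ t := hmono _ _ (one_le_pow₀ (by norm_num)) h1
          have h5 : 1 / ((t : ℝ) ^ 2 * Ψ t) ≤ 2 * y := by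
            calc 1 / ((t : ℝ) ^ 2 * Ψ t) ≤ 1 / (4 ^ (k + 1) * Ψ (2 ^ (k + 1))) :=
                  one_div_le_one_div_of_le (by positivity)
                    (mul_le_mul h3 h4 hΨk.le (by positivity))
              _ = 2 * y := by rw [hy]; field_simp
          have h6 : 0 < Ψ t := hΨk.trans_le h4
          refine mul_le_mul h2 ?_ (by positivity) (by positivity)
          calc _ ≤ (2 * y) ^ s := Real.rpow_le_rpow (by positivity) h5 hs.1.le
            _ = 2 ^ s * y ^ s := Real.mul_rpow (by norm_num) hy0.le
            _ ≤ 2 * y ^ s := by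
                refine mul_le_mul_of_nonneg_right ?_ (by positivity)
                calc (2 : ℝ) ^ s ≤ 2 ^ (1 : ℝ) :=
                      Real.rpow_le_rpow_of_exponent_le (by norm_num) hs.2.le
                  _ = 2 := Real.rpow_one 2
      _ = 16 * v k := by
          rw [Finset.sum_const, card_Ico_two_pow, nsmul_eq_mul]
          have : (4 : ℝ) ^ k = 2 ^ k * 2 ^ k := by rw [← mul_pow]; norm_num
          simp only [hv, this]
          push_cast
          ring
  intro hsum
  refine hdiv (summable_of_sum_range_le (c := ∑ t ∈ Finset.range 2, f t + 16 * ∑' k, v k) hf0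
    fun n => ?_)
  have hdyadic : ∀ n, ∑ t ∈ Finset.range (2 ^ (n + 1)), f t
      ≤ ∑ t ∈ Finset.range 2, f t + 16 * ∑ k ∈ Finset.range n, v k := by
    intro n
    induction n with
    | zero => simp
    | succ n ih =>
      rw [← Finset.sum_range_add_sum_Ico f (show 2 ^ (n + 1) ≤ 2 ^ (n + 2) from
        Nat.pow_le_pow_right (by norm_num) (by lia)), Finset.sum_range_succ v n]
      linarith [hblock n]
  calc _ ≤ ∑ t ∈ Finset.range (2 ^ (n + 1)), f t :=
        Finset.sum_le_sum_of_subset_of_nonneg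
          (Finset.range_mono ((Nat.le_succ n).trans Nat.lt_two_pow_self.le)) fun t _ _ => hf0 t
    _ ≤ _ := hdyadic n
    _ ≤ _ := by
        have := hsum.sum_le_tsum (Finset.range n) fun k _ => hv0 k
        linarith

theorem jarnik_divergence (Ψ : ℝ → ℝ) (hpos : ∀ t, 1 ≤ t → 0 < Ψ t)
    (hmono : ∀ s t : ℝ, 1 ≤ s → s ≤ t → Ψ s ≤ Ψ t)
    (s : ℝ) (hs : s ∈ Set.Ioo (0 : ℝ) 1)
    (hdiv : ¬ Summable (fun t : ℕ => (t : ℝ) * (1 / ((t : ℝ) ^ 2 * Ψ t)) ^ s)) :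
    (MeasureTheory.Measure.hausdorffMeasure s : MeasureTheory.Measure ℝ)
      {x ∈ Set.Ico (0 : ℝ) 1 |
        {pq : ℤ × ℕ | 0 < pq.2 ∧
          |x - (pq.1 : ℝ) / pq.2| < 1 / ((pq.2 : ℝ) ^ 2 * Ψ pq.2)}.Infinite} = ⊤ := by
  set u : ℕ → ℝ := fun k => 1 / (2 * (4 ^ (k + 1) * Ψ (2 ^ (k + 1)))) with hu
  have hΨ : ∀ k : ℕ, 0 < Ψ (2 ^ k) := fun k => hpos _ (one_le_pow₀ (by norm_num))
  have hu0 : ∀ k, 0 < u k := fun k => by have := hΨ (k + 1); positivity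
  have hu4 : ∀ k, u (k + 1) ≤ u k / 4 := by
    intro k
    have h1 := hΨ (k + 1)
    have h2 : Ψ (2 ^ (k + 1)) ≤ Ψ (2 ^ (k + 1 + 1)) := hmono _ _ (one_le_pow₀ (by norm_num))
      (pow_le_pow_right₀ (by norm_num) (Nat.le_succ _))
    simp only [hu]
    rw [div_div]
    refine one_div_le_one_div_of_le (by positivity) ?_
    rw [pow_succ (4 : ℝ) (k + 1)]
    have h3 : (0 : ℝ) < 4 ^ (k + 1) := by positivity
    nlinarith [mul_le_mul_of_nonneg_left h2 h3.le]
  refine top_unique ((hausdorffMeasure_limsup_eq_top hs hu0 hu4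
    (not_summable_dyadic hpos hmono hs hdiv)).symm.le.trans (measure_mono fun x hx => ⟨?_, ?_⟩))
  · obtain ⟨m, hm⟩ := exists_forall_mul_two_pow_le hu4 (show (0 : ℝ) < 1 / 2 by norm_num)
    obtain ⟨k, hk, i, hi, hxi⟩ := hx m
    have hbd := Icc_subset_unit_of_mem_dyadicFractions hi (r := 2 * u k)
      (by have := hu0 k; positivity) (by linarith [hm k hk])
    exact ⟨hbd.1.1.trans hxi.1, by linarith [hxi.2, hbd.2.2, hu0 k]⟩
  · refine Set.Infinite.of_image Prod.snd (Set.infinite_of_forall_exists_gt fun N => ?_)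
    obtain ⟨k, hk, ⟨q, p⟩, hi, hxi⟩ := hx N
    obtain ⟨⟨h1, h2⟩, -⟩ := mem_dyadicFractions.1 hi
    dsimp only at h1 h2 hxi
    have hkq : k < q := Nat.lt_two_pow_self.trans_le h1
    refine ⟨q, ⟨(p, q), ⟨(Nat.zero_le k).trans_lt hkq, ?_⟩, rfl⟩, hk.trans_lt hkq⟩
    have hq1 : (1 : ℝ) ≤ q := by exact_mod_cast Nat.one_le_of_lt hkq
    have hq2 : (q : ℝ) ≤ 2 ^ (k + 1) := by exact_mod_cast h2.le
    have hΨq := hpos q hq1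
    have h3 : (q : ℝ) ^ 2 ≤ 4 ^ (k + 1) := by
      calc (q : ℝ) ^ 2 ≤ (2 ^ (k + 1)) ^ 2 := pow_le_pow_left₀ (by positivity) hq2 2
        _ = _ := by rw [← pow_mul, mul_comm, pow_mul]; norm_num
    have h4 : u k < 1 / ((q : ℝ) ^ 2 * Ψ q) := by
      refine one_div_lt_one_div_of_lt (by positivity) ?_
      have h5 := mul_le_mul h3 (hmono _ _ hq1 hq2) hΨq.le (by positivity)
      have h6 : 0 < (q : ℝ) ^ 2 * Ψ q := by positivity
      linarith
    refine lt_of_le_of_lt ?_ h4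
    rw [Int.cast_natCast, abs_le]
    constructor <;> linarith [hxi.1, hxi.2, hu0 k]
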